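/- The inclusion CF_fin ⊂ CF_cb is proper: there is a capacity-bounded context-free language that is not a context-free language of finite index (indeed, is not even context-free). -/

import Mathlib

/-! Common definitions: symbols, context-free grammars, Ginsburg–Spanier phrase
structure grammars, capacity-bounded derivations, matrix/vector grammars,
finite index, cf Petri nets with place capacities, and language families. -/

inductive Symb (N T : Type) where
  | nt : N → Symb N T
  | tm : T → Symb N T
deriving DecidableEq

namespace CapGram

variable {N T Δ α : Type}

open Classical in
/-- Number of occurrences of the nonterminal `A` in a sentential form. -/
noncomputable def symCount (A : N) : List (Symb N T) → ℕ
  | [] => 0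
  | Symb.nt B :: r => (if B = A then 1 else 0) + symCount A r
  | Symb.tm _ :: r => symCount A r

/-- Total number of nonterminal occurrences in a sentential form. -/
def ntCount : List (Symb N T) → ℕ
  | [] => 0
  | Symb.nt _ :: r => 1 + ntCount r
  | Symb.tm _ :: r => ntCount r

/-- The sentential form `w` respects the capacity function `κ`. -/
def CapOK (κ : N → ℕ) (w : List (Symb N T)) : Prop :=
  ∀ A : N, symCount A w ≤ κ A

/-- A context-free grammar (rules are pairs of a nonterminal and a word). -/
structure CFG (N T : Type) where
  start : N
  rules : Finset (N × List (Symb N T))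

/-- Application of a single context-free rule. -/
def applyRule (r : N × List (Symb N T)) (u v : List (Symb N T)) : Prop :=
  ∃ x y : List (Symb N T), u = x ++ Symb.nt r.1 :: y ∧ v = x ++ r.2 ++ y

def CFG.Step (G : CFG N T) (u v : List (Symb N T)) : Prop :=
  ∃ r ∈ G.rules, applyRule r u v

/-- A derivation step both of whose sentential forms respect the capacity. -/
def CFG.CapStep (G : CFG N T) (κ : N → ℕ) (u v : List (Symb N T)) : Prop :=
  G.Step u v ∧ CapOK κ u ∧ CapOK κ v

/-- A derivation step both of whose sentential forms have at most `k`
nonterminal occurrences in total. -/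
def CFG.IdxStep (G : CFG N T) (k : ℕ) (u v : List (Symb N T)) : Prop :=
  G.Step u v ∧ ntCount u ≤ k ∧ ntCount v ≤ k

/-- The (unrestricted) language of a context-free grammar. -/
def CFG.Lang (G : CFG N T) : Set (List T) :=
  { w | Relation.ReflTransGen G.Step [Symb.nt G.start] (w.map Symb.tm) }

/-- The language of the capacity-bounded grammar `(G, κ)`. -/
def CFG.CapLang (G : CFG N T) (κ : N → ℕ) : Set (List T) :=
  { w | Relation.ReflTransGen (G.CapStep κ) [Symb.nt G.start] (w.map Symb.tm) }

/-- Words with a derivation of index at most `k`. -/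
def CFG.FinLang (G : CFG N T) (k : ℕ) : Set (List T) :=
  { w | Relation.ReflTransGen (G.IdxStep k) [Symb.nt G.start] (w.map Symb.tm) }

/-- A phrase structure grammar due to Ginsburg and Spanier: the left-hand side
of a rule is a nonempty word of nonterminals, encoded as head and tail. -/
structure GSG (N T : Type) where
  start : N
  rules : Finset ((N × List N) × List (Symb N T))

def GSG.Step (G : GSG N T) (u v : List (Symb N T)) : Prop :=
  ∃ r ∈ G.rules, ∃ x y : List (Symb N T),
    u = x ++ (r.1.1 :: r.1.2).map Symb.nt ++ y ∧ v = x ++ r.2 ++ y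

def GSG.CapStep (G : GSG N T) (κ : N → ℕ) (u v : List (Symb N T)) : Prop :=
  G.Step u v ∧ CapOK κ u ∧ CapOK κ v

def GSG.Lang (G : GSG N T) : Set (List T) :=
  { w | Relation.ReflTransGen G.Step [Symb.nt G.start] (w.map Symb.tm) }

def GSG.CapLang (G : GSG N T) (κ : N → ℕ) : Set (List T) :=
  { w | Relation.ReflTransGen (G.CapStep κ) [Symb.nt G.start] (w.map Symb.tm) }

/-- Derivations labeled by their sequence of context-free rules, where every
sentential form (including the first and last) satisfies the invariant `P`. -/
inductive DerivP (P : List (Symb N T) → Prop) :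
    List (N × List (Symb N T)) → List (Symb N T) → List (Symb N T) → Prop
  | nil (u : List (Symb N T)) : P u → DerivP P [] u u
  | cons {r π u v w} : P u → applyRule r u v → DerivP P π v w →
      DerivP P (r :: π) u w

/-- A matrix grammar: a finite set of matrices (sequences of cf rules). -/
structure MG (N T : Type) where
  start : N
  mats : Finset (List (N × List (Symb N T)))

/-- Matrix language: rule sequences are concatenations of matrices. -/
def MG.Lang (G : MG N T) : Set (List T) :=
  { w | ∃ ms : List (List (N × List (Symb N T))),
      (∀ m ∈ ms, m ∈ G.mats) ∧
      DerivP (fun _ => True) ms.flatten [Symb.nt G.start] (w.map Symb.tm) }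

/-- Words with a matrix derivation of index at most `k`. -/
def MG.FinLang (G : MG N T) (k : ℕ) : Set (List T) :=
  { w | ∃ ms : List (List (N × List (Symb N T))),
      (∀ m ∈ ms, m ∈ G.mats) ∧
      DerivP (fun u => ntCount u ≤ k) ms.flatten [Symb.nt G.start] (w.map Symb.tm) }

/-- `Shuffle ms π`: `π` is an interleaving (shuffle) of the lists in `ms`. -/
inductive Shuffle : List (List α) → List α → Prop
  | nil (ms : List (List α)) : (∀ l ∈ ms, l = []) → Shuffle ms []
  | cons {ms₁ : List (List α)} {l : List α} {ms₂ : List (List α)} {π : List α}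
      (a : α) : Shuffle (ms₁ ++ l :: ms₂) π →
      Shuffle (ms₁ ++ (a :: l) :: ms₂) (a :: π)

/-- A vector grammar: like a matrix grammar, but derivations use shuffles. -/
structure VG (N T : Type) where
  start : N
  mats : Finset (List (N × List (Symb N T)))

def VG.Lang (G : VG N T) : Set (List T) :=
  { w | ∃ ms π, (∀ m ∈ ms, m ∈ G.mats) ∧ Shuffle ms π ∧
      DerivP (fun _ => True) π [Symb.nt G.start] (w.map Symb.tm) }

def VG.CapLang (G : VG N T) (κ : N → ℕ) : Set (List T) :=
  { w | ∃ ms π, (∀ m ∈ ms, m ∈ G.mats) ∧ Shuffle ms π ∧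
      DerivP (CapOK κ) π [Symb.nt G.start] (w.map Symb.tm) }

def VG.FinLang (G : VG N T) (k : ℕ) : Set (List T) :=
  { w | ∃ ms π, (∀ m ∈ ms, m ∈ G.mats) ∧ Shuffle ms π ∧
      DerivP (fun u => ntCount u ≤ k) π [Symb.nt G.start] (w.map Symb.tm) }

/-! cf Petri nets: places are in bijection with the nonterminals, transitions
with the rules; firing the transition of rule `A → α` consumes one token from
the place of `A` and adds `|α|_X` tokens to the place of each nonterminal `X`. -/

open Classical in
/-- Firing of the transition corresponding to rule `r`, turning marking `μ`
into marking `μ'`. -/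
noncomputable def ruleFire (r : N × List (Symb N T)) (μ μ' : N → ℕ) : Prop :=
  1 ≤ μ r.1 ∧ ∀ A, μ' A = μ A - (if A = r.1 then 1 else 0) + symCount A r.2

/-- Occurrence sequences of the cf Petri net of `G`, all of whose markings
(including initial and final) satisfy the validity predicate `P`. -/
inductive FireSeqP (G : CFG N T) (P : (N → ℕ) → Prop) :
    List (N × List (Symb N T)) → (N → ℕ) → (N → ℕ) → Prop
  | nil (μ : N → ℕ) : P μ → FireSeqP G P [] μ μ
  | cons {r π μ μ' μ''} : r ∈ G.rules → P μ → ruleFire r μ μ' →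
      FireSeqP G P π μ' μ'' → FireSeqP G P (r :: π) μ μ''

open Classical in
/-- The initial marking: one token on the place of the start symbol. -/
noncomputable def initMark (G : CFG N T) : N → ℕ :=
  fun A => if A = G.start then 1 else 0

/-- The language of `G` controlled by its cf Petri net restricted to markings
satisfying `P` (e.g. a place capacity constraint). -/
def CFG.PNLang (G : CFG N T) (P : (N → ℕ) → Prop) : Set (List T) :=
  { w | ∃ π μ, DerivP (fun _ => True) π [Symb.nt G.start] (w.map Symb.tm) ∧
      FireSeqP G P π (initMark G) μ }

/-! Language families over a terminal alphabet `T`. -/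

/-- Context-free languages of finite index. -/
def CFfin (T : Type) : Set (Set (List T)) :=
  { L | ∃ (N : Type) (_ : Fintype N) (G : CFG N T) (k : ℕ),
      L = G.Lang ∧ G.Lang ⊆ G.FinLang k }

/-- Languages of capacity-bounded context-free grammars. -/
def CFcb (T : Type) : Set (Set (List T)) :=
  { L | ∃ (N : Type) (_ : Fintype N) (G : CFG N T) (κ : N → ℕ),
      L = G.CapLang κ }

/-- Languages of capacity-bounded Ginsburg–Spanier phrase structure grammars. -/
def GScb (T : Type) : Set (Set (List T)) :=
  { L | ∃ (N : Type) (_ : Fintype N) (G : GSG N T) (κ : N → ℕ),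
      L = G.CapLang κ }

/-- Matrix languages of finite index. -/
def MATfin (T : Type) : Set (Set (List T)) :=
  { L | ∃ (N : Type) (_ : Fintype N) (G : MG N T) (k : ℕ),
      L = G.Lang ∧ G.Lang ⊆ G.FinLang k }

/-- Capacity-bounded vector languages (erasing rules allowed). -/
def Vcb (T : Type) : Set (Set (List T)) :=
  { L | ∃ (N : Type) (_ : Fintype N) (G : VG N T) (κ : N → ℕ),
      L = G.CapLang κ }

/-- Vector languages of finite index (erasing rules allowed). -/
def Vfin (T : Type) : Set (Set (List T)) :=
  { L | ∃ (N : Type) (_ : Fintype N) (G : VG N T) (k : ℕ),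
      L = G.Lang ∧ G.Lang ⊆ G.FinLang k }

/-- Languages of grammars controlled by cf Petri nets with place capacities. -/
def PNcap (T : Type) : Set (Set (List T)) :=
  { L | ∃ (N : Type) (_ : Fintype N) (G : CFG N T) (κ : N → ℕ),
      L = G.PNLang (fun μ => ∀ A, μ A ≤ κ A) }


open Symbol in
/-- `Yields g s w`: the sentential form `s` of `g` rewrites to the terminal word `w`,
presented as a forest of derivation trees. -/
inductive Yields (g : ContextFreeGrammar T) : List (Symbol T g.NT) → List T → Prop
  | nil : Yields g [] []
  | terminal (t : T) {s w} : Yields g s w → Yields g (terminal t :: s) (t :: w)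
  | nonterminal {r s v w} : r ∈ g.rules → Yields g r.output v → Yields g s w →
      Yields g (nonterminal r.input :: s) (v ++ w)

namespace Yields

variable {g : ContextFreeGrammar T}

theorem map_terminal (w : List T) : Yields g (w.map Symbol.terminal) w := by
  induction w with
  | nil => exact nil
  | cons t w ih => exact terminal t ih

theorem exists_of_append {s₁ s₂ : List (Symbol T g.NT)} {w : List T}
    (h : Yields g (s₁ ++ s₂) w) :
    ∃ w₁ w₂, w = w₁ ++ w₂ ∧ Yields g s₁ w₁ ∧ Yields g s₂ w₂ := by
  induction s₁ generalizing w with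
  | nil => exact ⟨[], w, rfl, nil, h⟩
  | cons x s₁ ih =>
    cases h with
    | terminal t h =>
      obtain ⟨w₁, w₂, rfl, h₁, h₂⟩ := ih h
      exact ⟨t :: w₁, w₂, rfl, terminal t h₁, h₂⟩
    | nonterminal hr hv h =>
      obtain ⟨w₁, w₂, rfl, h₁, h₂⟩ := ih h
      exact ⟨_ ++ w₁, w₂, by simp, nonterminal hr hv h₁, h₂⟩

theorem of_rewrites {r : ContextFreeRule T g.NT} (hr : r ∈ g.rules)
    {s s' : List (Symbol T g.NT)} (h : r.Rewrites s s') {w : List T} (hw : Yields g s' w) :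
    Yields g s w := by
  induction h generalizing w with
  | head s =>
    obtain ⟨w₁, w₂, rfl, h₁, h₂⟩ := hw.exists_of_append
    exact nonterminal hr h₁ h₂
  | cons x _ ih =>
    cases hw with
    | terminal t h => exact terminal t (ih h)
    | nonterminal hr' hv h => exact nonterminal hr' hv (ih h)

theorem of_derives {s : List (Symbol T g.NT)} {w : List T}
    (h : g.Derives s (w.map Symbol.terminal)) : Yields g s w := by
  induction h using Relation.ReflTransGen.head_induction_on with
  | refl => exact map_terminal w
  | head h _ ih =>
    obtain ⟨r, hr, h⟩ := h
    exact ih.of_rewrites hr h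

theorem derives_nonterminal_cons {r : ContextFreeRule T g.NT} (hr : r ∈ g.rules)
    (s : List (Symbol T g.NT)) :
    g.Derives (Symbol.nonterminal r.input :: s) (r.output ++ s) :=
  ContextFreeGrammar.Produces.single ⟨r, hr, .head s⟩

theorem derives {s : List (Symbol T g.NT)} {w : List T} (h : Yields g s w) :
    g.Derives s (w.map Symbol.terminal) := by
  induction h with
  | nil => rfl
  | terminal t _ ih => exact ih.append_left [Symbol.terminal t]
  | @nonterminal r s v w hr _ _ ihv ihw =>
    rw [List.map_append]
    exact (derives_nonterminal_cons hr s).trans ((ihv.append_right s).trans (ihw.append_left _))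

/-- If `w` is long compared to `s`, some node of the derivation forest yields a factor of `w`
whose length lies in a prescribed window. -/
theorem exists_factor {m K : ℕ} (hm : ∀ r ∈ g.rules, r.output.length ≤ m) (hK : 0 < K)
    {s : List (Symbol T g.NT)} {w : List T} (h : Yields g s w) (hw : s.length * K < w.length) :
    ∃ r ∈ g.rules, ∃ u v x, w = u ++ v ++ x ∧ K < v.length ∧ v.length ≤ m * K ∧
      g.Derives [Symbol.nonterminal r.input] (v.map Symbol.terminal) ∧
      g.Derives s
        (u.map Symbol.terminal ++ Symbol.nonterminal r.input :: x.map Symbol.terminal) := by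
  induction h with
  | nil => simp at hw
  | @terminal t s w _ ih =>
    simp only [List.length_cons, Nat.succ_mul] at hw
    obtain ⟨r, hr, u, v, x, rfl, h₁, h₂, h₃, h₄⟩ := ih (by omega)
    exact ⟨r, hr, t :: u, v, x, by simp, h₁, h₂, h₃, h₄.append_left [Symbol.terminal t]⟩
  | @nonterminal r s v w hr hv hs ihv ihs =>
    simp only [List.length_cons, List.length_append, Nat.succ_mul] at hw
    by_cases hsw : s.length * K < w.length
    · obtain ⟨r', hr', u, v', x, rfl, h₁, h₂, h₃, h₄⟩ := ihs hsw
      refine ⟨r', hr', v ++ u, v', x, by simp, h₁, h₂, h₃, ?_⟩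
      have := (derives_nonterminal_cons hr s).trans
        ((hv.derives.append_right s).trans (h₄.append_left _))
      simpa using this
    by_cases hvm : v.length ≤ m * K
    · refine ⟨r, hr, [], v, w, by simp, by omega, hvm, ?_, ?_⟩
      · simpa using (derives_nonterminal_cons hr []).trans (by simpa using hv.derives)
      · exact hs.derives.append_left [Symbol.nonterminal r.input]
    · have := Nat.mul_le_mul_right K (hm r hr)
      obtain ⟨r', hr', u, v', x, rfl, h₁, h₂, h₃, h₄⟩ := ihv (by omega)
      refine ⟨r', hr', u, v', x ++ w, by simp, h₁, h₂, h₃, ?_⟩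
      have := (derives_nonterminal_cons hr s).trans
        ((h₄.append_right s).trans (hs.derives.append_left _))
      simpa using this

end Yields

/-- An interchange lemma: in an infinite family of words of a context-free language, two members
of widely different size have factors of widely different size that can be exchanged. The factors
may moreover be assumed to agree on any finite colouring of the factorizations. -/
theorem interchange {L : Language T} (hL : L.IsContextFree) :
    ∃ m, ∀ (z : ℕ → List T) (Q : Type) [Finite Q] (χ : List T → List T → List T → Q),
      (∀ K, 0 < K → z K ∈ L ∧ K < (z K).length) →
      ∃ K K' u v x u' v' x', z K = u ++ v ++ x ∧ z K' = u' ++ v' ++ x' ∧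
        χ u v x = χ u' v' x' ∧ v.length ≤ m * K ∧ v'.length ≤ m * K' ∧ v.length < v'.length ∧
        u ++ v' ++ x ∈ L ∧ u' ++ v ++ x' ∈ L := by
  obtain ⟨g, rfl⟩ := hL
  refine ⟨g.rules.sup (fun r => r.output.length), fun z Q _ χ hz => ?_⟩
  set m := g.rules.sup (fun r => r.output.length)
  have key (K : ℕ) : ∃ (r : g.rules) (u v x : List T), z (K + 1) = u ++ v ++ x ∧
      K + 1 < v.length ∧ v.length ≤ m * (K + 1) ∧
      g.Derives [Symbol.nonterminal r.1.input] (v.map Symbol.terminal) ∧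
      g.Derives [Symbol.nonterminal g.initial]
        (u.map Symbol.terminal ++ Symbol.nonterminal r.1.input :: x.map Symbol.terminal) := by
    obtain ⟨hmem, hlen⟩ := hz (K + 1) K.succ_pos
    obtain ⟨r, hr, h⟩ := (Yields.of_derives hmem).exists_factor
      (fun r hr => Finset.le_sup (f := fun r => r.output.length) hr) K.succ_pos (by simpa using hlen)
    exact ⟨⟨r, hr⟩, h⟩
  choose r u v x hzK hlow hupp hder hctx using key
  obtain ⟨c, hc⟩ := Finite.exists_infinite_fiber (fun K => (r K, χ (u K) (v K) (x K)))
  rw [Set.infinite_coe_iff] at hc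
  obtain ⟨K, hK⟩ := hc.nonempty
  obtain ⟨K', hK', hlt⟩ := hc.exists_gt (m * (K + 1))
  have hcol := hK.trans hK'.symm
  simp only [Prod.mk.injEq] at hcol
  have swap {A : g.NT} {u v x : List T}
      (h₁ : g.Derives [Symbol.nonterminal A] (v.map Symbol.terminal))
      (h₂ : g.Derives [Symbol.nonterminal g.initial]
        (u.map Symbol.terminal ++ Symbol.nonterminal A :: x.map Symbol.terminal)) :
      u ++ v ++ x ∈ g.language := by
    have := h₂.trans ((h₁.append_right (x.map Symbol.terminal)).append_left (u.map Symbol.terminal))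
    simpa using this
  refine ⟨K + 1, K' + 1, u K, v K, x K, u K', v K', x K', hzK K, hzK K', hcol.2, hupp K, hupp K',
    ?_, swap (hder K') (hcol.1 ▸ hctx K), swap (hder K) (hcol.1 ▸ hctx K')⟩
  have := hupp K
  have := hlow K'
  omega

/-- Every language of a grammar in the sense of `CFG` is context-free in Mathlib's sense. -/
theorem CFG.isContextFree_lang (G : CFG N T) : Language.IsContextFree G.Lang := by
  classical
  let e : Symb N T → Symbol T N
    | Symb.nt A => Symbol.nonterminal A
    | Symb.tm t => Symbol.terminal t
  have he : Function.Injective e := by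
    rintro (A | t) (B | t') h <;> simp_all [e]
  let g : ContextFreeGrammar T :=
    ⟨N, G.start, G.rules.image fun r => ⟨r.1, r.2.map e⟩⟩
  have hstep (s : List (Symb N T)) (s' : List (Symbol T N)) :
      g.Produces (s.map e) s' ↔ ∃ t, s' = t.map e ∧ G.Step s t := by
    constructor
    · rintro ⟨r, hr, h⟩
      obtain ⟨r, hrG, rfl⟩ := Finset.mem_image.1 hr
      obtain ⟨p, q, hs, rfl⟩ := h.exists_parts
      rw [List.append_assoc, List.singleton_append] at hs
      obtain ⟨p, s₂, rfl, rfl, hs₂⟩ := List.map_eq_append_iff.1 hs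
      obtain ⟨a, q, rfl, ha, rfl⟩ := List.map_eq_cons_iff.1 hs₂
      obtain rfl : a = Symb.nt r.1 := he ha
      exact ⟨p ++ r.2 ++ q, by simp, r, hrG, p, q, rfl, rfl⟩
    · rintro ⟨t, rfl, r, hr, p, q, rfl, rfl⟩
      refine ⟨⟨r.1, r.2.map e⟩, Finset.mem_image_of_mem _ hr, ?_⟩
      rw [ContextFreeRule.rewrites_iff]
      exact ⟨p.map e, q.map e, by simp [e], by simp⟩
  have hder (s t : List (Symb N T)) :
      g.Derives (s.map e) (t.map e) ↔ Relation.ReflTransGen G.Step s t := by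
    constructor
    · intro h
      suffices ∀ t', g.Derives (s.map e) t' → ∃ t, t' = t.map e ∧ Relation.ReflTransGen G.Step s t by
        obtain ⟨t', ht, h⟩ := this _ h
        rwa [he.list_map ht]
      intro t' h
      induction h with
      | refl => exact ⟨s, rfl, .refl⟩
      | tail _ h ih =>
        obtain ⟨t, rfl, ht⟩ := ih
        obtain ⟨t', rfl, h'⟩ := (hstep t _).1 h
        exact ⟨t', rfl, ht.tail h'⟩
    · intro h
      induction h with
      | refl => rfl
      | tail _ h ih => exact ih.trans_produces ((hstep _ _).2 ⟨_, rfl, h⟩)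
  refine ⟨g, Set.ext fun w => ?_⟩
  have := hder [Symb.nt G.start] (w.map Symb.tm)
  change g.Derives [Symbol.nonterminal G.start] _ ↔ Relation.ReflTransGen G.Step _ _
  simpa [e, Function.comp_def] using this

/-- The terminal alphabet of the separating language. -/
inductive Letter
  | a | b | c | dot | sep
deriving DecidableEq

open Letter

/-- The separating grammar: two tokens move on a cycle of three places. A forward move emits a
pair `a … b`, a backward move emits `c`, and a token leaves the cycle by emitting `dot`. -/
def tokenGrammar : CFG (Option (ZMod 3)) Letter where
  start := none
  rules := {(none, [Symb.nt (some 0), Symb.tm sep, Symb.nt (some 1)])} ∪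
    (Finset.univ.image fun i : ZMod 3 =>
      (some i, [Symb.tm a, Symb.nt (some (i + 1)), Symb.tm b])) ∪
    (Finset.univ.image fun i : ZMod 3 => (some i, [Symb.tm c, Symb.nt (some (i - 1))])) ∪
    (Finset.univ.image fun i : ZMod 3 => (some i, [Symb.tm dot]))

theorem mem_rules_tokenGrammar {r : Option (ZMod 3) × List (Symb (Option (ZMod 3)) Letter)} :
    r ∈ tokenGrammar.rules ↔ r = (none, [Symb.nt (some 0), Symb.tm sep, Symb.nt (some 1)]) ∨
      ∃ i : ZMod 3, r = (some i, [Symb.tm a, Symb.nt (some (i + 1)), Symb.tm b]) ∨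
        r = (some i, [Symb.tm c, Symb.nt (some (i - 1))]) ∨ r = (some i, [Symb.tm dot]) := by
  simp only [tokenGrammar, Finset.mem_union, Finset.mem_singleton, Finset.mem_image,
    Finset.mem_univ, true_and, eq_comm (a := r), exists_or, or_assoc]

theorem symCount_append (A : N) (s t : List (Symb N T)) :
    symCount A (s ++ t) = symCount A s + symCount A t := by
  induction s with
  | nil => simp [symCount]
  | cons x s ih => cases x <;> simp [symCount, ih, add_assoc]

theorem symCount_map_tm (A : N) (w : List T) : symCount A (w.map Symb.tm) = 0 := by
  induction w with
  | nil => rfl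
  | cons t w ih => simpa [symCount] using ih

/-- The symbol representing a token: its place on the cycle, or `dot` once it has left. -/
def tokenSymb : Option (ZMod 3) → Symb (Option (ZMod 3)) Letter
  | none => Symb.tm dot
  | some i => Symb.nt (some i)

/-- The sentential form in which the tokens in states `o` and `o'` have emitted the words
`u` and `y` to their left. -/
def tokenForm (u : List Letter) (o : Option (ZMod 3)) (y : List Letter) (o' : Option (ZMod 3)) :
    List (Symb (Option (ZMod 3)) Letter) :=
  u.map Symb.tm ++ tokenSymb o :: ((List.replicate (u.count a) b).map Symb.tm ++
    Symb.tm sep :: (y.map Symb.tm ++ tokenSymb o' :: (List.replicate (y.count a) b).map Symb.tm))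

theorem capOK_tokenForm {u y : List Letter} {o o' : Option (ZMod 3)} :
    CapOK (fun _ => 1) (tokenForm u o y o') ↔ (o = o' → o = none) := by
  have key (A : Option (ZMod 3)) : symCount A (tokenForm u o y o') =
      symCount A [tokenSymb o] + symCount A [tokenSymb o'] := by
    cases o <;> cases o' <;>
      simp [tokenForm, symCount_append, symCount_map_tm, symCount, tokenSymb, -List.map_replicate]
  simp only [CapOK, key]
  constructor
  · rintro h rfl
    cases o with
    | none => rfl
    | some i => simpa [tokenSymb, symCount] using h (some i)
  · intro h A
    cases o <;> cases o' <;> simp [tokenSymb, symCount] <;> split_ifs <;> simp_all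

theorem exists_eq_of_map_tm_append {u : List T} {s : Symb N T} {r x y : List (Symb N T)} {A : N}
    (h : u.map Symb.tm ++ s :: r = x ++ Symb.nt A :: y) :
    (x = u.map Symb.tm ∧ s = Symb.nt A ∧ r = y) ∨
      ∃ x', x = u.map Symb.tm ++ s :: x' ∧ r = x' ++ Symb.nt A :: y := by
  induction u generalizing x with
  | nil => cases x <;> simp_all
  | cons t u ih =>
    cases x with
    | nil => simp at h
    | cons t' x =>
      simp only [List.map_cons, List.cons_append, List.cons.injEq] at h
      obtain ⟨rfl, h⟩ := h
      simpa using ih h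

/-- The moves of a single token, recorded through the word emitted to its left. -/
inductive TokenMove : List Letter → Option (ZMod 3) → List Letter → Option (ZMod 3) → Prop
  | forward (u i) : TokenMove u (some i) (u ++ [a]) (some (i + 1))
  | backward (u i) : TokenMove u (some i) (u ++ [c]) (some (i - 1))
  | leave (u i) : TokenMove u (some i) u none

theorem step_tokenForm_iff {u y : List Letter} {o o' : Option (ZMod 3)}
    {w : List (Symb (Option (ZMod 3)) Letter)} :
    tokenGrammar.Step (tokenForm u o y o') w ↔
      (∃ u₁ o₁, TokenMove u o u₁ o₁ ∧ w = tokenForm u₁ o₁ y o') ∨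
      ∃ y₁ o₁, TokenMove y o' y₁ o₁ ∧ w = tokenForm u o y₁ o₁ := by
  constructor
  · rintro ⟨r, hr, p, q, h, rfl⟩
    rcases exists_eq_of_map_tm_append h with ⟨rfl, ho, rfl⟩ | ⟨p₁, rfl, h₁⟩
    · left
      cases o with
      | none => simp [tokenSymb] at ho
      | some i =>
        rcases mem_rules_tokenGrammar.1 hr with rfl | ⟨j, rfl | rfl | rfl⟩ <;>
          simp only [tokenSymb, Symb.nt.injEq, Option.some.injEq, reduceCtorEq] at ho <;> subst ho
        · exact ⟨_, _, .forward u i, by simp [tokenForm, tokenSymb, List.replicate_succ]⟩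
        · exact ⟨_, _, .backward u i, by simp [tokenForm, tokenSymb]⟩
        · exact ⟨_, _, .leave u i, by simp [tokenForm, tokenSymb]⟩
    · right
      rcases exists_eq_of_map_tm_append h₁ with ⟨-, h₂, -⟩ | ⟨p₂, rfl, h₂⟩
      · simp at h₂
      rcases exists_eq_of_map_tm_append h₂ with ⟨rfl, ho, rfl⟩ | ⟨p₃, rfl, h₃⟩
      · cases o' with
        | none => simp [tokenSymb] at ho
        | some i =>
          rcases mem_rules_tokenGrammar.1 hr with rfl | ⟨j, rfl | rfl | rfl⟩ <;>
            simp only [tokenSymb, Symb.nt.injEq, Option.some.injEq, reduceCtorEq] at ho <;> subst ho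
          · exact ⟨_, _, .forward y i, by simp [tokenForm, tokenSymb, List.replicate_succ]⟩
          · exact ⟨_, _, .backward y i, by simp [tokenForm, tokenSymb]⟩
          · exact ⟨_, _, .leave y i, by simp [tokenForm, tokenSymb]⟩
      · have : Symb.nt r.1 ∈ (List.replicate (y.count a) b).map Symb.tm := h₃ ▸ by simp
        simp at this
  · rintro (⟨_, _, h, rfl⟩ | ⟨_, _, h, rfl⟩)
    · cases h with
      | forward i =>
        exact ⟨_, mem_rules_tokenGrammar.2 (.inr ⟨i, .inl rfl⟩), u.map Symb.tm, _, rfl,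
          by simp [tokenForm, tokenSymb, List.replicate_succ]⟩
      | backward i =>
        exact ⟨_, mem_rules_tokenGrammar.2 (.inr ⟨i, .inr (.inl rfl)⟩), u.map Symb.tm, _, rfl,
          by simp [tokenForm, tokenSymb]⟩
      | leave i =>
        exact ⟨_, mem_rules_tokenGrammar.2 (.inr ⟨i, .inr (.inr rfl)⟩), u.map Symb.tm, _, rfl,
          by simp [tokenForm, tokenSymb]⟩
    · let p := u.map Symb.tm ++ tokenSymb o :: ((List.replicate (u.count a) b).map Symb.tm ++
        Symb.tm sep :: y.map Symb.tm)
      cases h with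
      | forward i =>
        exact ⟨_, mem_rules_tokenGrammar.2 (.inr ⟨i, .inl rfl⟩), p,
          (List.replicate (y.count a) b).map Symb.tm, by simp [tokenForm, tokenSymb, p],
          by simp [tokenForm, tokenSymb, List.replicate_succ, p]⟩
      | backward i =>
        exact ⟨_, mem_rules_tokenGrammar.2 (.inr ⟨i, .inr (.inl rfl)⟩), p,
          (List.replicate (y.count a) b).map Symb.tm, by simp [tokenForm, tokenSymb, p],
          by simp [tokenForm, tokenSymb, p]⟩
      | leave i =>
        exact ⟨_, mem_rules_tokenGrammar.2 (.inr ⟨i, .inr (.inr rfl)⟩), p,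
          (List.replicate (y.count a) b).map Symb.tm, by simp [tokenForm, tokenSymb, p],
          by simp [tokenForm, tokenSymb, p]⟩

/-- The language of the separating grammar with all capacities equal to one. -/
def tokenLang : Set (List Letter) :=
  tokenGrammar.CapLang fun _ => 1

/-- The test words; by `le_of_mem_tokenLang`, the token language imposes `p ≤ q` on them. -/
def testWord (p q : ℕ) : List Letter :=
  List.replicate p a ++ dot :: (List.replicate p b ++
    sep :: (List.replicate q a ++ c :: c :: dot :: List.replicate q b))

theorem map_tm_testWord (p q : ℕ) : (testWord p q).map Symb.tm =
    tokenForm (List.replicate p a) none (List.replicate q a ++ [c, c]) none := by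
  simp [tokenForm, tokenSymb, testWord]

theorem capStep_tokenForm {u y u₁ y₁ : List Letter} {o o' o₁ o₁' : Option (ZMod 3)}
    (h : (TokenMove u o u₁ o₁ ∧ y = y₁ ∧ o' = o₁') ∨ (u = u₁ ∧ o = o₁ ∧ TokenMove y o' y₁ o₁'))
    (hne : o = o' → o = none) (hne' : o₁ = o₁' → o₁ = none) :
    tokenGrammar.CapStep (fun _ => 1) (tokenForm u o y o') (tokenForm u₁ o₁ y₁ o₁') := by
  refine ⟨step_tokenForm_iff.2 ?_, capOK_tokenForm.2 hne, capOK_tokenForm.2 hne'⟩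
  rcases h with ⟨h, rfl, rfl⟩ | ⟨rfl, rfl, h⟩
  · exact .inl ⟨_, _, h, rfl⟩
  · exact .inr ⟨_, _, h, rfl⟩

theorem capStep_start : tokenGrammar.CapStep (fun _ => 1) [Symb.nt none]
    (tokenForm [] (some 0) [] (some 1)) := by
  refine ⟨⟨_, mem_rules_tokenGrammar.2 (.inl rfl), [], [], rfl, rfl⟩, fun A => ?_,
    capOK_tokenForm.2 (by decide)⟩
  simp only [symCount]
  split_ifs <;> simp

theorem testWord_mem_tokenLang (n : ℕ) : testWord n n ∈ tokenLang := by
  have hne : ∀ i : ZMod 3, i ≠ i + 1 ∧ i ≠ i + 1 + 1 ∧ i + 1 ≠ i + 1 + 1 := by decide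
  have loop : Relation.ReflTransGen (tokenGrammar.CapStep fun _ => 1) [Symb.nt none]
      (tokenForm (List.replicate n a) (some (n : ZMod 3))
        (List.replicate n a) (some ((n : ZMod 3) + 1))) := by
    induction n with
    | zero => simpa using Relation.ReflTransGen.single capStep_start
    | succ n ih =>
      obtain ⟨h₁, h₂, h₃⟩ := hne n
      rw [List.replicate_succ', Nat.cast_succ]
      refine (ih.tail (capStep_tokenForm (.inr ⟨rfl, rfl, .forward _ _⟩) ?_ ?_)).tail
        (capStep_tokenForm (.inl ⟨.forward _ _, rfl, rfl⟩) ?_ ?_) <;> simp_all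
  have h₁ := loop.tail (capStep_tokenForm (.inl ⟨.leave _ _, rfl, rfl⟩)
    (by simp) (by simp))
  have h₂ := h₁.tail (capStep_tokenForm (.inr ⟨rfl, rfl, .backward _ _⟩) (by simp) (by simp))
  have h₃ := h₂.tail (capStep_tokenForm (.inr ⟨rfl, rfl, .backward _ _⟩) (by simp) (by simp))
  have h₄ := h₃.tail (capStep_tokenForm (.inr ⟨rfl, rfl, .leave _ _⟩) (by simp) (by simp))
  change Relation.ReflTransGen _ [Symb.nt none] ((testWord n n).map Symb.tm)
  rw [map_tm_testWord]
  simpa using h₄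

/-- The invariant relating the words emitted by the two tokens, as long as the left token has only
moved forward and the right one has moved forward and then backward. -/
def TokenInv (u : List Letter) (o : Option (ZMod 3)) (y : List Letter) (o' : Option (ZMod 3)) :
    Prop :=
  ∀ p q k, u = List.replicate p a → y = List.replicate q a ++ List.replicate k c →
    (k ≤ 1 ∨ (o = none ∧ p ≤ q)) ∧ (o' ≠ none → p ≤ q) ∧
    ∀ i, o = some i → ∀ j, o' = some j →
      i = p ∧ j = 1 + q - k ∧ p + k ≤ q ∧ q ≤ p + 1

theorem append_singleton_eq_replicate {x t : T} {u : List T} {p : ℕ}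
    (h : u ++ [x] = List.replicate p t) : x = t ∧ ∃ p', p = p' + 1 ∧ u = List.replicate p' t := by
  cases p with
  | zero => simp at h
  | succ p =>
    rw [List.replicate_succ'] at h
    obtain ⟨h, hx⟩ := List.append_inj' h rfl
    exact ⟨by simpa using hx, p, rfl, h⟩

theorem append_singleton_eq_replicate_append {x s t : T} {u : List T} {q k : ℕ}
    (h : u ++ [x] = List.replicate q s ++ List.replicate k t) :
    (x = s ∧ k = 0 ∧ ∃ q', q = q' + 1 ∧ u = List.replicate q' s) ∨
      (x = t ∧ ∃ k', k = k' + 1 ∧ u = List.replicate q s ++ List.replicate k' t) := by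
  cases k with
  | zero =>
    obtain ⟨rfl, h⟩ := append_singleton_eq_replicate (by simpa using h)
    exact .inl ⟨rfl, rfl, h⟩
  | succ k =>
    rw [List.replicate_succ', ← List.append_assoc] at h
    obtain ⟨h, hx⟩ := List.append_inj' h rfl
    exact .inr ⟨by simpa using hx, k, rfl, h⟩

theorem TokenInv.left {u y u₁ : List Letter} {o o' o₁ : Option (ZMod 3)} (h : TokenInv u o y o')
    (hm : TokenMove u o u₁ o₁) (hne : o₁ = o' → o₁ = none) : TokenInv u₁ o₁ y o' := by
  rintro p q k hu hy
  cases hm with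
  | forward i =>
    obtain ⟨-, p, rfl, hu₁⟩ := append_singleton_eq_replicate hu
    obtain ⟨h₁, h₂, h₃⟩ := h p q k hu₁ hy
    have hk : k ≤ 1 := by simpa using h₁
    cases o' with
    | none => simp [hk]
    | some j =>
      obtain ⟨rfl, rfl, h₄, h₅⟩ := h₃ i rfl j rfl
      have hpq : p + 1 + k ≤ q := by
        by_contra hlt
        obtain rfl : q = p + k := by omega
        exact absurd (hne (congrArg some (by push_cast; ring))) (by simp)
      refine ⟨.inl hk, fun _ => by omega, ?_⟩
      rintro _ ⟨⟩ _ ⟨⟩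
      exact ⟨by push_cast; ring, rfl, hpq, by omega⟩
  | backward i => exact absurd (append_singleton_eq_replicate hu).1 (by decide)
  | leave i =>
    obtain ⟨h₁, h₂, -⟩ := h p q k hu hy
    exact ⟨.inl (by simpa using h₁), h₂, by simp⟩

theorem TokenInv.right {u y y₁ : List Letter} {o o' o₁ : Option (ZMod 3)} (h : TokenInv u o y o')
    (hm : TokenMove y o' y₁ o₁) (hne : o = o₁ → o = none) : TokenInv u o y₁ o₁ := by
  have three : (3 : ZMod 3) = 0 := by decide
  rintro p q k hu hy
  cases hm with
  | forward j =>
    obtain ⟨-, rfl, q, rfl, hy₁⟩ | ⟨h, -⟩ := append_singleton_eq_replicate_append hy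
    swap
    · exact absurd h (by decide)
    obtain ⟨-, h₂, h₃⟩ := h p q 0 hu (by simpa using hy₁)
    have hpq : p ≤ q := by simpa using h₂
    refine ⟨.inl (by simp), fun _ => by omega, ?_⟩
    rintro i rfl _ ⟨⟩
    obtain ⟨rfl, rfl, h₄, h₅⟩ := h₃ i rfl j rfl
    refine ⟨rfl, by push_cast; ring, by omega, ?_⟩
    by_contra hlt
    obtain rfl : q = p + 1 := by omega
    simp only [reduceCtorEq, imp_false, Option.some.injEq] at hne
    apply hne
    push_cast
    linear_combination -three
  | backward j =>
    obtain ⟨h, -⟩ | ⟨-, k, rfl, hy₁⟩ := append_singleton_eq_replicate_append hy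
    · exact absurd h (by decide)
    obtain ⟨h₁, h₂, h₃⟩ := h p q k hu hy₁
    have hpq : p ≤ q := by simpa using h₂
    cases o with
    | none => exact ⟨.inr ⟨rfl, hpq⟩, fun _ => hpq, by simp⟩
    | some i =>
      obtain ⟨rfl, rfl, h₄, h₅⟩ := h₃ i rfl j rfl
      have hk : p + k + 1 ≤ q := by
        by_contra hlt
        obtain rfl : q = p + k := by omega
        exact absurd (hne (congrArg some (by push_cast; ring))) (by simp)
      refine ⟨.inl (by omega), fun _ => hpq, ?_⟩
      rintro _ ⟨⟩ _ ⟨⟩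
      exact ⟨rfl, by push_cast; ring, by omega, h₅⟩
  | leave j =>
    obtain ⟨h₁, -, -⟩ := h p q k hu hy
    exact ⟨h₁, by simp, by simp⟩

theorem eq_start_or_tokenForm {w : List (Symb (Option (ZMod 3)) Letter)}
    (h : Relation.ReflTransGen (tokenGrammar.CapStep fun _ => 1) [Symb.nt none] w) :
    w = [Symb.nt none] ∨ ∃ u o y o', w = tokenForm u o y o' ∧ TokenInv u o y o' := by
  induction h with
  | refl => exact .inl rfl
  | tail _ hstep ih =>
    right
    obtain ⟨hstep, -, hcap⟩ := hstep
    rcases ih with rfl | ⟨u, o, y, o', rfl, hinv⟩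
    · obtain ⟨r, hr, p, q, h, rfl⟩ := hstep
      obtain ⟨rfl, hA, rfl⟩ : p = [] ∧ none = r.1 ∧ q = [] := by
        cases p <;> simp_all
      rcases mem_rules_tokenGrammar.1 hr with rfl | ⟨j, rfl | rfl | rfl⟩ <;>
        simp only [reduceCtorEq] at hA
      refine ⟨[], some 0, [], some 1, rfl, ?_⟩
      rintro p q k hu hy
      obtain rfl : p = 0 := by simpa using (congrArg List.length hu).symm
      obtain ⟨rfl, rfl⟩ : q = 0 ∧ k = 0 := by simpa using (congrArg List.length hy).symm
      refine ⟨.inl (by simp), by simp, ?_⟩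
      rintro i ⟨⟩ j ⟨⟩
      simp
    · rcases step_tokenForm_iff.1 hstep with ⟨u₁, o₁, hm, rfl⟩ | ⟨y₁, o₁, hm, rfl⟩
      · exact ⟨_, _, _, _, rfl, hinv.left hm (capOK_tokenForm.1 hcap)⟩
      · exact ⟨_, _, _, _, rfl, hinv.right hm (capOK_tokenForm.1 hcap)⟩

/-- Words shaped like test words belong to the token language only if they are test words
`testWord p q` with `p ≤ q`. -/
theorem le_of_mem_tokenLang {p p' q q' : ℕ}
    (h : List.replicate p a ++ dot :: (List.replicate p' b ++
      sep :: (List.replicate q a ++ c :: c :: dot :: List.replicate q' b)) ∈ tokenLang) :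
    p' = p ∧ q' = q ∧ p ≤ q := by
  obtain h | ⟨u, o, y, o', h, hinv⟩ := eq_start_or_tokenForm h
  · cases p <;> simp [List.replicate_succ] at h
  have notMem {w w' : List Letter} {o : Option (ZMod 3)} {r : List (Symb (Option (ZMod 3)) Letter)}
      (h : w.map Symb.tm = w'.map Symb.tm ++ tokenSymb o :: r) : o = none := by
    cases o with
    | none => rfl
    | some i =>
      have : Symb.nt (some i) ∈ w.map Symb.tm := by rw [h]; simp [tokenSymb]
      simp at this
  obtain rfl := notMem h
  obtain rfl : o' = none := by
    refine notMem (w' := u ++ dot :: (List.replicate (u.count a) b ++ sep :: y))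
      (r := (List.replicate (y.count a) b).map Symb.tm) (h.trans ?_)
    simp only [tokenForm, tokenSymb, List.map_append, List.map_cons, List.append_assoc,
      List.cons_append]
  have hw : (List.replicate p a ++ dot :: List.replicate p' b) ++
      sep :: ((List.replicate q a ++ [c, c]) ++ dot :: List.replicate q' b) =
      (u ++ dot :: List.replicate (u.count a) b) ++
        sep :: (y ++ dot :: List.replicate (y.count a) b) := by
    have hinj : Function.Injective (Symb.tm : Letter → Symb (Option (ZMod 3)) Letter) :=
      fun _ _ h => by simpa using h
    apply hinj.list_map
    simpa [tokenForm, tokenSymb] using h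
  obtain ⟨hl, -, hr⟩ := (List.append_cons_inj_of_notMem (by simp) (by simp)).1 hw
  obtain ⟨rfl, -, hp⟩ := (List.append_cons_inj_of_notMem (by simp) (by simp)).1 hl
  obtain ⟨rfl, -, hq⟩ := (List.append_cons_inj_of_notMem (by simp) (by simp)).1 hr
  obtain ⟨h₁, -, -⟩ := hinv p q 2 rfl rfl
  refine ⟨?_, ?_, by simpa using h₁⟩
  · simpa using congrArg List.length hp
  · simpa using congrArg List.length hq

/-- An automaton accepting the words shaped like test words. -/
def shapeDFA : DFA Letter (Fin 7) where
  step
    | 0, a => 0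
    | 0, dot => 1
    | 1, b => 1
    | 1, sep => 2
    | 2, a => 2
    | 2, c => 3
    | 3, c => 4
    | 4, dot => 5
    | 5, b => 5
    | _, _ => 6
  start := 0
  accept := {5}

theorem evalFrom_replicate {σ : Type} (M : DFA T σ) {s : σ} {t : T} (h : M.step s t = s) (n : ℕ) :
    M.evalFrom s (List.replicate n t) = s := by
  induction n with
  | zero => rfl
  | succ n ih => rw [List.replicate_succ, DFA.evalFrom_cons, h, ih]

theorem testWord_mem_accepts (p q : ℕ) : testWord p q ∈ shapeDFA.accepts := by
  have h₀ := evalFrom_replicate shapeDFA (s := 0) (t := a) rfl p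
  have h₁ := evalFrom_replicate shapeDFA (s := 1) (t := b) rfl p
  have h₂ := evalFrom_replicate shapeDFA (s := 2) (t := a) rfl q
  have h₅ := evalFrom_replicate shapeDFA (s := 5) (t := b) rfl q
  change shapeDFA.evalFrom 0 _ = 5
  rw [testWord, DFA.evalFrom_of_append, h₀, DFA.evalFrom_cons]
  change shapeDFA.evalFrom 1 _ = 5
  rw [DFA.evalFrom_of_append, h₁, DFA.evalFrom_cons]
  change shapeDFA.evalFrom 2 _ = 5
  rw [DFA.evalFrom_of_append, h₂]
  exact h₅

theorem exists_of_mem_accepts_shapeDFA {w : List Letter} (hw : w ∈ shapeDFA.accepts) :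
    ∃ p p' q q', w = List.replicate p a ++ dot :: (List.replicate p' b ++
      sep :: (List.replicate q a ++ c :: c :: dot :: List.replicate q' b)) := by
  have h₆ (w : List Letter) : shapeDFA.evalFrom 6 w ≠ 5 := by
    have : shapeDFA.evalFrom 6 w = 6 := by
      induction w with
      | nil => rfl
      | cons t w ih => cases t <;> exact ih
    rw [this]
    decide
  have h₅ (w : List Letter) (h : shapeDFA.evalFrom 5 w = 5) : ∃ q', w = List.replicate q' b := by
    induction w with
    | nil => exact ⟨0, rfl⟩
    | cons t w ih =>
      cases t with
      | b =>
        obtain ⟨q', rfl⟩ := ih h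
        exact ⟨q' + 1, rfl⟩
      | _ => exact absurd h (h₆ w)
  have h₄ (w : List Letter) (h : shapeDFA.evalFrom 4 w = 5) :
      ∃ q', w = dot :: List.replicate q' b := by
    cases w with
    | nil => exact absurd h (by decide)
    | cons t w =>
      cases t with
      | dot =>
        obtain ⟨q', rfl⟩ := h₅ w h
        exact ⟨q', rfl⟩
      | _ => exact absurd h (h₆ w)
  have h₃ (w : List Letter) (h : shapeDFA.evalFrom 3 w = 5) :
      ∃ q', w = c :: dot :: List.replicate q' b := by
    cases w with
    | nil => exact absurd h (by decide)
    | cons t w =>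
      cases t with
      | c =>
        obtain ⟨q', rfl⟩ := h₄ w h
        exact ⟨q', rfl⟩
      | _ => exact absurd h (h₆ w)
  have h₂ (w : List Letter) (h : shapeDFA.evalFrom 2 w = 5) :
      ∃ q q', w = List.replicate q a ++ c :: c :: dot :: List.replicate q' b := by
    induction w with
    | nil => exact absurd h (by decide)
    | cons t w ih =>
      cases t with
      | a =>
        obtain ⟨q, q', rfl⟩ := ih h
        exact ⟨q + 1, q', rfl⟩
      | c =>
        obtain ⟨q', rfl⟩ := h₃ w h
        exact ⟨0, q', rfl⟩
      | _ => exact absurd h (h₆ w)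
  have h₁ (w : List Letter) (h : shapeDFA.evalFrom 1 w = 5) :
      ∃ p' q q', w = List.replicate p' b ++
        sep :: (List.replicate q a ++ c :: c :: dot :: List.replicate q' b) := by
    induction w with
    | nil => exact absurd h (by decide)
    | cons t w ih =>
      cases t with
      | b =>
        obtain ⟨p', q, q', rfl⟩ := ih h
        exact ⟨p' + 1, q, q', rfl⟩
      | sep =>
        obtain ⟨q, q', rfl⟩ := h₂ w h
        exact ⟨0, q, q', rfl⟩
      | _ => exact absurd h (h₆ w)
  replace hw : shapeDFA.evalFrom 0 w = 5 := hw
  induction w with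
  | nil => exact absurd hw (by decide)
  | cons t w ih =>
    cases t with
    | a =>
      obtain ⟨p, p', q, q', rfl⟩ := ih hw
      exact ⟨p + 1, p', q, q', rfl⟩
    | dot =>
      obtain ⟨p', q, q', rfl⟩ := h₁ w hw
      exact ⟨0, p', q, q', rfl⟩
    | _ => exact absurd hw (h₆ w)

theorem exists_testWord_of_mem {w : List Letter} (hw : w ∈ tokenLang)
    (hacc : w ∈ shapeDFA.accepts) : ∃ p q, p ≤ q ∧ w = testWord p q := by
  obtain ⟨p, p', q, q', rfl⟩ := exists_of_mem_accepts_shapeDFA hacc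
  obtain ⟨rfl, rfl, h⟩ := le_of_mem_tokenLang hw
  exact ⟨_, _, h, rfl⟩

theorem length_testWord (p q : ℕ) : (testWord p q).length = 2 * p + 2 * q + 5 := by
  simp only [testWord, List.length_append, List.length_cons, List.length_replicate]
  omega

theorem eq_of_prefix_testWord {n p q : ℕ} {u : List Letter} (hu : n < u.length)
    (h₁ : u <+: testWord n n) (h₂ : u <+: testWord p q) : p = n := by
  have h : List.replicate n a ++ [dot] <+: testWord n n := ⟨_, by simp [testWord]; rfl⟩
  obtain ⟨t, ht⟩ := (List.prefix_of_prefix_length_le h h₁ (by simpa)).trans h₂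
  have ht' : List.replicate n a ++ dot :: t = testWord p q := by simpa using ht
  rw [testWord] at ht'
  have := congrArg (List.idxOf dot) ht'
  simpa [List.idxOf_append, List.idxOf_cons] using this.symm

theorem eq_of_suffix_testWord {n p q : ℕ} {x : List Letter} (hx : n < x.length)
    (h₁ : x <:+ testWord n n) (h₂ : x <:+ testWord p q) : q = n := by
  have split (p q : ℕ) : ∃ t, testWord p q = t ++ dot :: List.replicate q b :=
    ⟨List.replicate p a ++ dot :: (List.replicate p b ++ sep :: (List.replicate q a ++ [c, c])),
      by simp [testWord]⟩
  obtain ⟨s, hs⟩ := split n n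
  have h : dot :: List.replicate n b <:+ testWord n n := ⟨s, hs.symm⟩
  obtain ⟨t, ht⟩ := (List.suffix_of_suffix_length_le h h₁ (by simpa)).trans h₂
  obtain ⟨t', ht'⟩ := split p q
  have := congrArg (fun l => List.idxOf dot l.reverse) (ht.trans ht')
  simpa [List.idxOf_append, List.idxOf_cons] using this.symm

theorem not_isContextFree_tokenLang : ¬ Language.IsContextFree tokenLang := by
  intro hL
  obtain ⟨m, h⟩ := interchange hL
  obtain ⟨K, K', u, v, x, u', v', x', hz, hz', hχ, hv, hv', hlt, hmem, hmem'⟩ :=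
    h (fun K => testWord ((m + 1) * K) ((m + 1) * K)) _
      (fun u v x => (shapeDFA.eval u, shapeDFA.eval (u ++ v), decide (u.length ≤ x.length)))
      (fun K _ => ⟨testWord_mem_tokenLang _, by rw [length_testWord]; nlinarith⟩)
  simp only [Prod.mk.injEq, decide_eq_decide] at hχ
  obtain ⟨hu, huv, hux⟩ := hχ
  replace hv : v.length ≤ (m + 1) * K := hv.trans (Nat.mul_le_mul_right K m.le_succ)
  replace hv' : v'.length ≤ (m + 1) * K' := hv'.trans (Nat.mul_le_mul_right K' m.le_succ)
  generalize (m + 1) * K = n at *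
  generalize (m + 1) * K' = n' at *
  have swap {u v x u' v' : List Letter} {n : ℕ} (hz : testWord n n = u ++ v ++ x)
      (hu : shapeDFA.eval u = shapeDFA.eval u')
      (huv : shapeDFA.eval (u ++ v) = shapeDFA.eval (u' ++ v')) :
      u ++ v' ++ x ∈ shapeDFA.accepts := by
    have := testWord_mem_accepts n n
    rw [hz] at this
    simp only [DFA.mem_accepts, DFA.eval, DFA.evalFrom_of_append] at this hu huv ⊢
    rwa [hu, ← huv]
  obtain ⟨p, q, hpq, hw⟩ := exists_testWord_of_mem hmem (swap hz hu huv)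
  obtain ⟨p', q', hpq', hw'⟩ := exists_testWord_of_mem hmem' (swap hz' hu.symm huv.symm)
  have hlen := congrArg List.length hz
  have hlen' := congrArg List.length hz'
  have hlenw := congrArg List.length hw
  have hlenw' := congrArg List.length hw'
  simp only [List.length_append, length_testWord] at hlen hlen' hlenw hlenw'
  by_cases hle : u.length ≤ x.length
  · have := eq_of_suffix_testWord (by omega) ⟨_, hz.symm⟩ ⟨_, hw⟩
    omega
  · have hle' := fun h => hle (hux.2 h)
    rw [List.append_assoc] at hz' hw'
    have := eq_of_prefix_testWord (u := u') (by omega) ⟨_, hz'.symm⟩ ⟨_, hw'⟩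
    omega

/-- the inclusion CF_fin ⊂ CF_cb is proper: some capacity-bounded
context-free language is not of finite index, and not even context-free. -/
theorem CFfin_proper_in_CFcb :
    ∃ (T : Type) (L : Set (List T)),
      L ∈ CFcb T ∧ L ∉ CFfin T ∧ ¬ Language.IsContextFree L := by
  refine ⟨Letter, tokenLang, ⟨_, inferInstance, tokenGrammar, _, rfl⟩, ?_,
    not_isContextFree_tokenLang⟩
  rintro ⟨N, -, G, k, h, -⟩
  exact not_isContextFree_tokenLang (h ▸ G.isContextFree_lang)

end CapGram
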